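/- arXiv:2601.10297 — 2 statements merged into one kernel-verified Lean document; each statement's English description precedes it below -/
import Mathlib

section
/- If B ⊂ ℝ^n is a ball centered at 0, w ∈ H²_loc(ℝ^n) satisfies Δw ≡ C almost everywhere with |C| ≥ 1, and v ∈ H²(B) satisfies v − w ∈ H₀²(B), then F(v,B) − F(w,B) = (C² − 1)·|B ∩ {v = 0}| + ∫_{B ∩ {v ≠ 0}} (Δ(v − w))² dx ≥ 0. -/
open MeasureTheory Metric Set Filter Topology
open scoped ENNReal

noncomputable section

/-- `n`-dimensional Euclidean space. -/
abbrev RH (n : ℕ) := EuclideanSpace ℝ (Fin n)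

variable {n : ℕ}

/-- Smooth compactly supported test functions with support contained in `Ω`. -/
def IsTestFun (Ω : Set (RH n)) (φ : RH n → ℝ) : Prop :=
  ContDiff ℝ (⊤ : ℕ∞) φ ∧ HasCompactSupport φ ∧ tsupport φ ⊆ Ω

/-- Classical partial derivative in the `i`-th coordinate direction. -/
def cpderiv (i : Fin n) (φ : RH n → ℝ) : RH n → ℝ :=
  fun x => fderiv ℝ φ x (EuclideanSpace.single i 1)

/-- Classical Laplacian of a (smooth) function. -/
def cLaplacian (φ : RH n → ℝ) : RH n → ℝ :=
  fun x => ∑ i, cpderiv i (cpderiv i φ) x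

/-- `g` is the weak `i`-th partial derivative of `u` on `Ω`. -/
def IsWeakPartial (Ω : Set (RH n)) (i : Fin n) (u g : RH n → ℝ) : Prop :=
  ∀ φ : RH n → ℝ, IsTestFun Ω φ →
    ∫ x in Ω, u x * cpderiv i φ x = - ∫ x in Ω, g x * φ x

/-- `g` is a weak Laplacian of `u` on `Ω`. -/
def IsWeakLaplacian (Ω : Set (RH n)) (u g : RH n → ℝ) : Prop :=
  ∀ φ : RH n → ℝ, IsTestFun Ω φ →
    ∫ x in Ω, u x * cLaplacian φ x = ∫ x in Ω, g x * φ x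

/-- `u ∈ H²(Ω)` with weak gradient `g` and weak Hessian `h`. -/
def IsH2With (Ω : Set (RH n)) (u : RH n → ℝ) (g : Fin n → RH n → ℝ)
    (h : Fin n → Fin n → RH n → ℝ) : Prop :=
  MemLp u 2 (volume.restrict Ω) ∧
  (∀ i, IsWeakPartial Ω i u (g i) ∧ MemLp (g i) 2 (volume.restrict Ω)) ∧
  (∀ i j, IsWeakPartial Ω j (g i) (h i j) ∧ MemLp (h i j) 2 (volume.restrict Ω))

/-- `u ∈ H²(Ω)`. -/
def MemH2 (Ω : Set (RH n)) (u : RH n → ℝ) : Prop :=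
  ∃ g h, IsH2With Ω u g h

/-- `u ∈ H₀²(Ω)`: `u ∈ H²(Ω)` and `u` is approximable in the `H²`-norm by
test functions supported in `Ω`. -/
def MemH20 (Ω : Set (RH n)) (u : RH n → ℝ) : Prop :=
  ∃ g h, IsH2With Ω u g h ∧
    ∃ φ : ℕ → RH n → ℝ, (∀ k, IsTestFun Ω (φ k)) ∧
      Tendsto (fun k => eLpNorm (fun x => u x - φ k x) 2 (volume.restrict Ω)) atTop (𝓝 0) ∧
      (∀ i, Tendsto (fun k => eLpNorm (fun x => g i x - cpderiv i (φ k) x) 2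
        (volume.restrict Ω)) atTop (𝓝 0)) ∧
      (∀ i j, Tendsto (fun k => eLpNorm (fun x => h i j x - cpderiv j (cpderiv i (φ k)) x) 2
        (volume.restrict Ω)) atTop (𝓝 0))

/-- `u ∈ H²_loc(ℝⁿ)`. -/
def MemH2loc (u : RH n → ℝ) : Prop :=
  ∀ Ω : Set (RH n), IsOpen Ω → Bornology.IsBounded Ω → MemH2 Ω u

/-- The two-sided biharmonic Alt–Caffarelli functional
`F(u,Ω) = ∫_Ω (Δu)² dx + |{x ∈ Ω : u x ≠ 0}|`, where the (weak) Laplacian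
`Δu = lapu` is given explicitly. -/
def ACF (Ω : Set (RH n)) (lapu u : RH n → ℝ) : ℝ :=
  (∫ x in Ω, (lapu x) ^ 2) + (volume {x ∈ Ω | u x ≠ 0}).toReal

/-- `u` is a global minimizer of the two-sided biharmonic Alt–Caffarelli functional. -/
def IsGlobalMinimizer (u : RH n → ℝ) : Prop :=
  MemH2loc u ∧
  ∀ Ω : Set (RH n), IsOpen Ω → Bornology.IsBounded Ω →
    ∀ v : RH n → ℝ, MemH2 Ω v → MemH20 Ω (fun x => v x - u x) →
      ∀ lapu lapv : RH n → ℝ, IsWeakLaplacian Ω u lapu → IsWeakLaplacian Ω v lapv →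
        ACF Ω lapu u ≤ ACF Ω lapv v


open scoped Convolution

/-- Scheffé's lemma: almost everywhere convergence together with an upper bound on the `L¹` norms
implies `L¹` convergence. -/
lemma tendsto_integral_abs_sub_of_ae_tendsto {α : Type*} [MeasurableSpace α] {μ : Measure α}
    {f : ℕ → α → ℝ} {g : α → ℝ} (hf : ∀ k, Integrable (f k) μ) (hg : Integrable g μ)
    (hlim : ∀ᵐ x ∂μ, Tendsto (fun k => f k x) atTop (𝓝 (g x)))
    (hle : ∀ k, ∫ x, |f k x| ∂μ ≤ ∫ x, |g x| ∂μ) :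
    Tendsto (fun k => ∫ x, |f k x - g x| ∂μ) atTop (𝓝 0) := by
  have hint : ∀ k, Integrable (fun x => |f k x - g x|) μ := fun k => ((hf k).sub hg).abs
  have key : Tendsto (fun k => ∫ x, (|f k x| + |g x| - |f k x - g x|) ∂μ) atTop
      (𝓝 (∫ x, (|g x| + |g x| - 0) ∂μ)) := by
    refine tendsto_integral_of_dominated_convergence (fun x => 2 * |g x|)
      (fun k => (((hf k).abs.add hg.abs).sub (hint k)).aestronglyMeasurable)
      (hg.abs.const_mul 2) (fun k => ae_of_all _ fun x => ?_) ?_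
    · rw [Real.norm_eq_abs, abs_le]
      have h1 := abs_sub (f k x) (g x)
      have h2 := abs_sub_abs_le_abs_sub (f k x) (g x)
      have h3 := abs_nonneg (g x)
      constructor <;> linarith
    · filter_upwards [hlim] with x hx
      have h0 : Tendsto (fun k => |f k x - g x|) atTop (𝓝 0) := by
        simpa using (hx.sub_const (g x)).abs
      exact (hx.abs.add tendsto_const_nhds).sub h0
  have e : ∀ k, ∫ x, (|f k x| + |g x| - |f k x - g x|) ∂μ
      = ∫ x, |f k x| ∂μ + ∫ x, |g x| ∂μ - ∫ x, |f k x - g x| ∂μ := fun k => by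
    rw [← integral_add (hf k).abs hg.abs]
    exact integral_sub ((hf k).abs.add hg.abs) (hint k)
  have e0 : ∫ x, (|g x| + |g x| - 0) ∂μ = ∫ x, |g x| ∂μ + ∫ x, |g x| ∂μ := by
    simp only [sub_zero]
    exact integral_add hg.abs hg.abs
  rw [e0] at key
  have up : Tendsto (fun k => (∫ x, |g x| ∂μ + ∫ x, |g x| ∂μ)
      - ∫ x, (|f k x| + |g x| - |f k x - g x|) ∂μ) atTop (𝓝 0) := by
    simpa using key.const_sub (∫ x, |g x| ∂μ + ∫ x, |g x| ∂μ)
  refine squeeze_zero (fun k => integral_nonneg fun x => abs_nonneg _) (fun k => ?_) up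
  rw [e]
  linarith [hle k]

/-- Convolution with a normalized bump function does not increase the `L¹` norm. -/
lemma integral_abs_normed_convolution_le (ρ : ContDiffBump (0 : RH n)) {f : RH n → ℝ}
    (hf : Integrable f) :
    ∫ x, |(ρ.normed volume ⋆[ContinuousLinearMap.lsmul ℝ ℝ, volume] f) x| ≤ ∫ x, |f x| := by
  have h1 : ∫ x, (ρ.normed volume ⋆[ContinuousLinearMap.lsmul ℝ ℝ, volume] fun y => |f y|) x
      = ∫ x, |f x| := by
    rw [integral_convolution _ ρ.integrable_normed hf.abs, ρ.integral_normed]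
    simp
  rw [← h1]
  refine integral_mono (ρ.integrable_normed.integrable_convolution _ hf).abs
    (ρ.integrable_normed.integrable_convolution _ hf.abs) fun x => ?_
  simp only [convolution_def]
  refine (abs_integral_le_integral_abs).trans_eq (integral_congr_ae (ae_of_all _ fun t => ?_))
  simp [abs_mul, abs_of_nonneg (ρ.nonneg_normed t)]

lemma IsTestFun.contDiff_cpderiv {Ω : Set (RH n)} {φ : RH n → ℝ} (hφ : IsTestFun Ω φ)
    (i : Fin n) : ContDiff ℝ (⊤ : ℕ∞) (cpderiv i φ) :=
  (hφ.1.fderiv_right (m := (⊤ : ℕ∞)) (by simp)).clm_apply contDiff_const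

lemma IsTestFun.cpderiv {Ω : Set (RH n)} {φ : RH n → ℝ} (hφ : IsTestFun Ω φ)
    (i : Fin n) : IsTestFun Ω (cpderiv i φ) := by
  have h : tsupport (_root_.cpderiv i φ) ⊆ tsupport φ :=
    (closure_mono fun x hx => by
      simp only [Function.mem_support, _root_.cpderiv] at hx ⊢
      intro h0
      exact hx (by rw [h0]; rfl)).trans (tsupport_fderiv_subset ℝ)
  exact ⟨hφ.contDiff_cpderiv i, hφ.2.1.of_isClosed_subset (isClosed_tsupport _) h,
    h.trans hφ.2.2⟩

lemma IsTestFun.exists_bound {Ω : Set (RH n)} {φ : RH n → ℝ} (hφ : IsTestFun Ω φ) :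
    ∃ M, ∀ x, ‖φ x‖ ≤ M :=
  hφ.2.1.exists_bound_of_continuous hφ.1.continuous

lemma IsTestFun.integrable {Ω : Set (RH n)} {φ : RH n → ℝ} (hφ : IsTestFun Ω φ) :
    Integrable φ :=
  hφ.1.continuous.integrable_of_hasCompactSupport hφ.2.1

lemma IsTestFun.integrable_mul {Ω s : Set (RH n)} {φ f : RH n → ℝ} (hφ : IsTestFun Ω φ)
    (hf : IntegrableOn f s) : IntegrableOn (fun x => f x * φ x) s := by
  obtain ⟨M, hM⟩ := hφ.exists_bound
  exact Integrable.mul_bdd hf hφ.1.continuous.aestronglyMeasurable (ae_of_all _ hM)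

/-- Mollification commutes with weak differentiation. -/
lemma cpderiv_normed_convolution {i : Fin n} {U G : RH n → ℝ} (hU : Integrable U)
    (hUG : IsWeakPartial univ i U G) (ρ : ContDiffBump (0 : RH n)) (x : RH n) :
    cpderiv i (ρ.normed volume ⋆[ContinuousLinearMap.lsmul ℝ ℝ, volume] U) x
      = (ρ.normed volume ⋆[ContinuousLinearMap.lsmul ℝ ℝ, volume] G) x := by
  have hρ : ContDiff ℝ (⊤ : ℕ∞) (ρ.normed (volume : Measure (RH n))) := ρ.contDiff_normed
  have hρc : HasCompactSupport (ρ.normed (volume : Measure (RH n))) := ρ.hasCompactSupport_normed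
  have hρ1 : ContDiff ℝ 1 (ρ.normed (volume : Measure (RH n))) := ρ.contDiff_normed (n := 1)
  have hd := hρc.hasFDerivAt_convolution_left (ContinuousLinearMap.lsmul ℝ ℝ)
    hρ1 hU.locallyIntegrable x
  have hcex := (hρc.fderiv ℝ).convolutionExists_left
    ((ContinuousLinearMap.lsmul ℝ ℝ).precompL (RH n)) (hρ1.continuous_fderiv one_ne_zero)
    hU.locallyIntegrable x
  have htest : IsTestFun univ (fun t => ρ.normed (volume : Measure (RH n)) (x - t)) :=
    ⟨hρ.comp (contDiff_const.sub contDiff_id),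
      hρc.comp_homeomorph (Homeomorph.subLeft x), subset_univ _⟩
  have hdt : ∀ t, cpderiv i (fun t => ρ.normed (volume : Measure (RH n)) (x - t)) t
      = - fderiv ℝ (ρ.normed volume) (x - t) (EuclideanSpace.single i 1) := fun t => by
    have := ((hρ1.differentiable one_ne_zero (x - t)).hasFDerivAt).comp t
      ((hasFDerivAt_const x t).sub (hasFDerivAt_id t))
    simp only [cpderiv]
    erw [this.fderiv]
    simp
  have h := hUG _ htest
  simp only [hdt, setIntegral_univ] at h
  have hswap : ∫ t, fderiv ℝ (ρ.normed volume) t (EuclideanSpace.single i 1) * U (x - t)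
      = ∫ t, fderiv ℝ (ρ.normed volume) (x - t) (EuclideanSpace.single i 1) * U t := by
    rw [← integral_sub_left_eq_self _ volume x]
    simp
  rw [cpderiv, hd.fderiv, convolution_def, convolution_eq_swap,
    ContinuousLinearMap.integral_apply hcex]
  simp only [ContinuousLinearMap.precompL_apply, ContinuousLinearMap.lsmul_apply, smul_eq_mul]
  rw [hswap]
  simp only [mul_neg, integral_neg, neg_inj] at h
  simpa only [mul_comm] using h

/-- Chain rule for weak derivatives of integrable functions. -/
lemma integral_comp_mul_cpderiv {i : Fin n} {U G : RH n → ℝ} (hU : Integrable U)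
    (hG : Integrable G) (hUG : IsWeakPartial univ i U G) {ψ ψ' : ℝ → ℝ}
    (hψ : ∀ t, HasDerivAt ψ (ψ' t) t) (hψ' : Continuous ψ') {M M' : ℝ}
    (hM : ∀ t, ‖ψ t‖ ≤ M) (hM' : ∀ t, ‖ψ' t‖ ≤ M') {φ : RH n → ℝ} (hφ : IsTestFun univ φ) :
    ∫ x, ψ (U x) * cpderiv i φ x = - ∫ x, ψ' (U x) * (G x * φ x) := by
  have hψc : Continuous ψ := continuous_iff_continuousAt.2 fun t => (hψ t).continuousAt
  obtain ⟨K, hK⟩ := hφ.exists_bound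
  let ρ : ℕ → ContDiffBump (0 : RH n) := fun k =>
    ⟨1 / ((k : ℝ) + 1), 2 * (1 / ((k : ℝ) + 1)), by positivity,
      lt_two_mul_self (by positivity)⟩
  have hρ : Tendsto (fun k => (ρ k).rOut) atTop (𝓝 0) := by
    have h := (tendsto_one_div_add_atTop_nhds_zero_nat (𝕜 := ℝ)).const_mul 2
    rwa [mul_zero] at h
  have hρ2 : ∀ᶠ k in atTop, (ρ k).rOut ≤ 2 * (ρ k).rIn := Eventually.of_forall fun k => le_rfl
  let m : ℕ → (RH n → ℝ) → RH n → ℝ := fun k f =>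
    (ρ k).normed volume ⋆[ContinuousLinearMap.lsmul ℝ ℝ, volume] f
  have hUlim := ContDiffBump.ae_convolution_tendsto_right_of_locallyIntegrable hρ hρ2
    hU.locallyIntegrable
  have hGlim := ContDiffBump.ae_convolution_tendsto_right_of_locallyIntegrable hρ hρ2
    hG.locallyIntegrable
  have hmG : ∀ k, Integrable (m k G) := fun k =>
    (ρ k).integrable_normed.integrable_convolution _ hG
  have hmU : ∀ k, ContDiff ℝ 1 (m k U) := fun k =>
    (ρ k).hasCompactSupport_normed.contDiff_convolution_left (n := 1) _ (ρ k).contDiff_normed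
      hU.locallyIntegrable
  have hL1 : Tendsto (fun k => ∫ x, |m k G x - G x|) atTop (𝓝 0) :=
    tendsto_integral_abs_sub_of_ae_tendsto hmG hG hGlim
      fun k => integral_abs_normed_convolution_le (ρ k) hG
  have hd : ∀ k x, fderiv ℝ (fun y => ψ (m k U y)) x (EuclideanSpace.single i 1)
      = ψ' (m k U x) * m k G x := fun k x => by
    have h1 := ((hψ (m k U x)).comp_hasFDerivAt x
      ((hmU k).differentiable one_ne_zero x).hasFDerivAt).fderiv
    have h2 : fderiv ℝ (m k U) x (EuclideanSpace.single i 1) = m k G x :=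
      cpderiv_normed_convolution hU hUG (ρ k) x
    have h3 : (fun y => ψ (m k U y)) = ψ ∘ m k U := rfl
    rw [h3, h1, ← h2]
    simp
  have hmeasU : ∀ {θ : ℝ → ℝ}, Continuous θ → ∀ k,
      AEStronglyMeasurable (fun x => θ (m k U x)) volume := fun hθ k =>
    (hθ.comp (hmU k).continuous).aestronglyMeasurable
  have hmGφ : ∀ k, Integrable (fun x => m k G x * φ x) := fun k => by
    simpa [integrableOn_univ] using hφ.integrable_mul (s := univ) (hmG k).integrableOn
  have hGφ : Integrable (fun x => G x * φ x) := by
    simpa [integrableOn_univ] using hφ.integrable_mul (s := univ) hG.integrableOn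
  have hψG : ∀ k, Integrable (fun x => ψ' (m k U x) * (m k G x * φ x)) := fun k =>
    (hmGφ k).bdd_mul (hmeasU hψ' k) (ae_of_all _ fun x => hM' _)
  have hψG' : ∀ k, Integrable (fun x => ψ' (m k U x) * (G x * φ x)) := fun k =>
    hGφ.bdd_mul (hmeasU hψ' k) (ae_of_all _ fun x => hM' _)
  have hparts : ∀ k, ∫ x, ψ (m k U x) * cpderiv i φ x
      = - ∫ x, ψ' (m k U x) * (m k G x * φ x) := fun k => by
    have := integral_mul_fderiv_eq_neg_fderiv_mul_of_integrable (μ := (volume : Measure (RH n)))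
      (f := fun y => ψ (m k U y)) (g := φ) (v := EuclideanSpace.single i 1)
      (by simpa only [hd, mul_assoc] using hψG k)
      ((hφ.cpderiv i).integrable.bdd_mul (hmeasU hψc k) (ae_of_all _ fun x => hM _))
      (hφ.integrable.bdd_mul (hmeasU hψc k) (ae_of_all _ fun x => hM _))
      (fun x _ => ((hψ _).differentiableAt).comp x ((hmU k).differentiable one_ne_zero x))
      (fun x _ => hφ.1.differentiable (by simp) x)
    simpa only [hd, mul_assoc, cpderiv] using this
  have hleft : Tendsto (fun k => ∫ x, ψ (m k U x) * cpderiv i φ x) atTop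
      (𝓝 (∫ x, ψ (U x) * cpderiv i φ x)) := by
    refine tendsto_integral_of_dominated_convergence (fun x => M * ‖cpderiv i φ x‖)
      (fun k => (hmeasU hψc k).mul (hφ.cpderiv i).integrable.aestronglyMeasurable)
      ((hφ.cpderiv i).integrable.norm.const_mul M) (fun k => ae_of_all _ fun x => ?_) ?_
    · rw [norm_mul]
      exact mul_le_mul_of_nonneg_right (hM _) (norm_nonneg _)
    · filter_upwards [hUlim] with x hx
      exact ((hψc.tendsto _).comp hx).mul_const _
  have hright1 : Tendsto (fun k => ∫ x, ψ' (m k U x) * (G x * φ x)) atTop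
      (𝓝 (∫ x, ψ' (U x) * (G x * φ x))) := by
    refine tendsto_integral_of_dominated_convergence (fun x => M' * ‖G x * φ x‖)
      (fun k => (hψG' k).aestronglyMeasurable)
      (hGφ.norm.const_mul M') (fun k => ae_of_all _ fun x => ?_) ?_
    · rw [norm_mul]
      exact mul_le_mul_of_nonneg_right (hM' _) (norm_nonneg _)
    · filter_upwards [hUlim] with x hx
      exact ((hψ'.tendsto _).comp hx).mul_const _
  have hdiff : Tendsto (fun k => ∫ x, (ψ' (m k U x) * (m k G x * φ x)
      - ψ' (m k U x) * (G x * φ x))) atTop (𝓝 0) := by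
    refine squeeze_zero_norm (a := fun k => (M' * K) * ∫ x, |m k G x - G x|) (fun k => ?_)
      (by simpa using hL1.const_mul (M' * K))
    rw [← integral_const_mul]
    refine norm_integral_le_of_norm_le (((hmG k).sub hG).abs.const_mul _)
      (ae_of_all _ fun x => ?_)
    have e : ψ' (m k U x) * (m k G x * φ x) - ψ' (m k U x) * (G x * φ x)
        = ψ' (m k U x) * φ x * (m k G x - G x) := by ring
    rw [e, norm_mul, norm_mul, ← Real.norm_eq_abs]
    have h1 := hM' (m k U x)
    have h2 := hK x
    gcongr
    exact (norm_nonneg _).trans h1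
  have hright : Tendsto (fun k => ∫ x, ψ' (m k U x) * (m k G x * φ x)) atTop
      (𝓝 (∫ x, ψ' (U x) * (G x * φ x))) := by
    have := hdiff.add hright1
    rw [zero_add] at this
    refine this.congr fun k => ?_
    rw [integral_sub (hψG k) (hψG' k)]
    ring
  refine tendsto_nhds_unique hleft ?_
  simp only [hparts]
  exact hright.neg

/-- Weak derivatives of an integrable function vanish almost everywhere on its zero set. -/
lemma ae_weakPartial_eq_zero_of_integrable {i : Fin n} {U G : RH n → ℝ} (hU : Integrable U)
    (hG : Integrable G) (hUG : IsWeakPartial univ i U G) :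
    ∀ᵐ x, U x = 0 → G x = 0 := by
  have hchain : ∀ (k : ℕ) (φ : RH n → ℝ), IsTestFun univ φ →
      ∫ x, ((k : ℝ) + 1)⁻¹ * Real.arctan (((k : ℝ) + 1) * U x) * cpderiv i φ x
        = - ∫ x, (1 / (1 + (((k : ℝ) + 1) * U x) ^ 2)) * (G x * φ x) := fun k φ hφ => by
    have hk : (0 : ℝ) < (k : ℝ) + 1 := by positivity
    refine integral_comp_mul_cpderiv hU hG hUG
      (ψ := fun t => ((k : ℝ) + 1)⁻¹ * Real.arctan (((k : ℝ) + 1) * t))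
      (ψ' := fun t => 1 / (1 + (((k : ℝ) + 1) * t) ^ 2))
      (M := ((k : ℝ) + 1)⁻¹ * (Real.pi / 2)) (M' := 1) (fun t => ?_) ?_ (fun t => ?_)
      (fun t => ?_) hφ
    · have h1 : HasDerivAt (fun t : ℝ => ((k : ℝ) + 1) * t) ((k : ℝ) + 1) t := by
        simpa using (hasDerivAt_id t).const_mul ((k : ℝ) + 1)
      convert! (h1.arctan).const_mul (((k : ℝ) + 1)⁻¹) using 1
      field_simp
    · exact continuous_const.div (by fun_prop) fun t => by positivity
    · rw [norm_mul, Real.norm_of_nonneg (inv_nonneg.2 hk.le), Real.norm_eq_abs]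
      exact mul_le_mul_of_nonneg_left (abs_le.2 ⟨(Real.neg_pi_div_two_lt_arctan _).le,
        (Real.arctan_lt_pi_div_two _).le⟩) (inv_nonneg.2 hk.le)
    · rw [Real.norm_of_nonneg (by positivity), div_le_one (by positivity)]
      nlinarith [sq_nonneg (((k : ℝ) + 1) * t)]
  have hUm := hU.aestronglyMeasurable
  have hzero : ∀ φ : RH n → ℝ, IsTestFun univ φ →
      ∫ x, ({x | U x = 0}.indicator (fun _ => (1 : ℝ)) x) * (G x * φ x) = 0 := fun φ hφ => by
    have hGφ : Integrable (fun x => G x * φ x) := by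
      simpa [integrableOn_univ] using hφ.integrable_mul (s := univ) hG.integrableOn
    have hleft : Tendsto (fun k : ℕ => ∫ x, ((k : ℝ) + 1)⁻¹ *
        Real.arctan (((k : ℝ) + 1) * U x) * cpderiv i φ x) atTop (𝓝 0) := by
      refine squeeze_zero_norm
        (a := fun k : ℕ => (1 / ((k : ℝ) + 1)) * ∫ x, (Real.pi / 2) * ‖cpderiv i φ x‖)
        (fun k => ?_) (by simpa using (tendsto_one_div_add_atTop_nhds_zero_nat
          (𝕜 := ℝ)).mul_const (∫ x, (Real.pi / 2) * ‖cpderiv i φ x‖))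
      rw [← integral_const_mul]
      refine norm_integral_le_of_norm_le
        (((hφ.cpderiv i).integrable.norm.const_mul _).const_mul _) (ae_of_all _ fun x => ?_)
      rw [norm_mul, norm_mul, Real.norm_of_nonneg (by positivity), one_div, mul_assoc]
      gcongr
      rw [Real.norm_eq_abs]
      exact abs_le.2 ⟨(Real.neg_pi_div_two_lt_arctan _).le, (Real.arctan_lt_pi_div_two _).le⟩
    have hright : Tendsto (fun k : ℕ => ∫ x, (1 / (1 + (((k : ℝ) + 1) * U x) ^ 2))
        * (G x * φ x)) atTop
        (𝓝 (∫ x, ({x | U x = 0}.indicator (fun _ => (1 : ℝ)) x) * (G x * φ x))) := by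
      refine tendsto_integral_of_dominated_convergence (fun x => ‖G x * φ x‖)
        (fun k => ?_) hGφ.norm (fun k => ae_of_all _ fun x => ?_) (ae_of_all _ fun x => ?_)
      · have hc : Continuous fun t : ℝ => 1 / (1 + (((k : ℝ) + 1) * t) ^ 2) :=
          continuous_const.div (by fun_prop) fun t => by positivity
        exact (hc.comp_aestronglyMeasurable hUm).mul hGφ.aestronglyMeasurable
      · rw [norm_mul, Real.norm_of_nonneg (by positivity)]
        refine mul_le_of_le_one_left (norm_nonneg _) ?_
        rw [div_le_one (by positivity)]
        nlinarith [sq_nonneg (((k : ℝ) + 1) * U x)]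
      · refine Tendsto.mul_const _ ?_
        by_cases hx : U x = 0
        · simp [hx]
        · simp only [indicator, mem_ofPred_eq, hx, if_false]
          refine tendsto_const_nhds.div_atTop (tendsto_atTop_add_const_left _ _ ?_)
          simp only [mul_pow]
          refine Tendsto.atTop_mul_const (by positivity) ?_
          exact (tendsto_pow_atTop two_ne_zero).comp
            (tendsto_atTop_add_const_right _ _ tendsto_natCast_atTop_atTop)
    have h2 : Tendsto (fun k : ℕ => ∫ x, (1 / (1 + (((k : ℝ) + 1) * U x) ^ 2))
        * (G x * φ x)) atTop (𝓝 0) := by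
      simpa using (hleft.congr fun k => hchain k φ hφ).neg
    exact tendsto_nhds_unique hright h2
  have hmeas : NullMeasurableSet {x | U x = 0} :=
    hUm.aemeasurable.nullMeasurable (measurableSet_singleton (0 : ℝ))
  have hint : Integrable (({x | U x = 0}).indicator G) := hG.indicator₀ hmeas
  have := ae_eq_zero_of_integral_contDiff_smul_eq_zero hint.locallyIntegrable
    fun φ h1 h2 => by
      refine (integral_congr_ae (ae_of_all _ fun x => ?_)).trans
        (hzero φ ⟨h1, h2, subset_univ _⟩)
      by_cases hx : U x = 0 <;> simp [indicator, hx, mul_comm]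
  filter_upwards [this] with x hx h0
  simpa [indicator, h0] using hx

lemma IsTestFun.mul {Ω : Set (RH n)} {χ φ : RH n → ℝ} (hχ : IsTestFun Ω χ)
    (hφ : ContDiff ℝ (⊤ : ℕ∞) φ) : IsTestFun Ω (fun x => χ x * φ x) :=
  ⟨hχ.1.mul hφ, hχ.2.1.mul_right, (tsupport_mul_subset_left (f := χ) (g := φ)).trans hχ.2.2⟩

lemma IsTestFun.eq_zero_of_notMem {Ω : Set (RH n)} {φ : RH n → ℝ} (hφ : IsTestFun Ω φ)
    {x : RH n} (hx : x ∉ Ω) : φ x = 0 :=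
  image_eq_zero_of_notMem_tsupport fun h => hx (hφ.2.2 h)

lemma ContDiffBump.isTestFun {c : RH n} (χ : ContDiffBump c) {Ω : Set (RH n)}
    (h : closedBall c χ.rOut ⊆ Ω) : IsTestFun Ω χ :=
  ⟨χ.contDiff, χ.hasCompactSupport, by rwa [χ.tsupport_eq]⟩

lemma cpderiv_mul {i : Fin n} {χ φ : RH n → ℝ} (hχ : ContDiff ℝ (⊤ : ℕ∞) χ)
    (hφ : ContDiff ℝ (⊤ : ℕ∞) φ) (x : RH n) :
    cpderiv i (fun y => χ y * φ y) x = χ x * cpderiv i φ x + cpderiv i χ x * φ x := by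
  simp only [cpderiv]
  rw [fderiv_fun_mul (hχ.differentiable (by simp) x) (hφ.differentiable (by simp) x)]
  simp [mul_comm]

/-- Multiplication by a test function turns local weak derivatives into global ones. -/
lemma IsWeakPartial.mul_isTestFun {Ω : Set (RH n)} {i : Fin n} {u g χ : RH n → ℝ}
    (hu : IntegrableOn u Ω) (hg : IntegrableOn g Ω)
    (hug : IsWeakPartial Ω i u g) (hχ : IsTestFun Ω χ) :
    IsWeakPartial univ i (fun x => u x * χ x) (fun x => g x * χ x + u x * cpderiv i χ x) := by
  intro φ hφ
  have h := hug _ (hχ.mul hφ.1)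
  simp only [cpderiv_mul hχ.1 hφ.1] at h
  have e1 : ∫ x in Ω, u x * (χ x * cpderiv i φ x + cpderiv i χ x * φ x)
      = (∫ x in Ω, u x * χ x * cpderiv i φ x) + ∫ x in Ω, u x * cpderiv i χ x * φ x := by
    refine Eq.trans (integral_congr_ae (ae_of_all _ fun x => ?_))
      (integral_add ((hφ.cpderiv i).integrable_mul (hχ.integrable_mul hu))
        (hφ.integrable_mul ((hχ.cpderiv i).integrable_mul hu)))
    dsimp only
    ring
  have e2 : ∫ x in Ω, (g x * χ x + u x * cpderiv i χ x) * φ x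
      = (∫ x in Ω, g x * (χ x * φ x)) + ∫ x in Ω, u x * cpderiv i χ x * φ x := by
    refine Eq.trans (integral_congr_ae (ae_of_all _ fun x => ?_))
      (integral_add ((hχ.mul hφ.1).integrable_mul hg)
        (hφ.integrable_mul ((hχ.cpderiv i).integrable_mul hu)))
    dsimp only
    ring
  have s1 : ∫ x in Ω, u x * χ x * cpderiv i φ x = ∫ x, u x * χ x * cpderiv i φ x :=
    setIntegral_eq_integral_of_forall_compl_eq_zero fun x hx => by
      simp [hχ.eq_zero_of_notMem hx]
  have s2 : ∫ x in Ω, (g x * χ x + u x * cpderiv i χ x) * φ x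
      = ∫ x, (g x * χ x + u x * cpderiv i χ x) * φ x :=
    setIntegral_eq_integral_of_forall_compl_eq_zero fun x hx => by
      simp [hχ.eq_zero_of_notMem hx, (hχ.cpderiv i).eq_zero_of_notMem hx]
  rw [setIntegral_univ, setIntegral_univ, ← s1, ← s2]
  linarith

/-- Weak derivatives vanish almost everywhere on the zero set of the function. -/
lemma IsWeakPartial.ae_eq_zero {c : RH n} {R : ℝ} (hR : 0 < R) {i : Fin n} {u g : RH n → ℝ}
    (hu : IntegrableOn u (ball c R)) (hg : IntegrableOn g (ball c R))
    (hug : IsWeakPartial (ball c R) i u g) :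
    ∀ᵐ x ∂volume.restrict (ball c R), u x = 0 → g x = 0 := by
  have hr : ∀ k : ℕ, R * (1 - 1 / ((k : ℝ) + 2)) < R := fun k => by
    have : 0 < 1 / ((k : ℝ) + 2) := by positivity
    nlinarith
  have hr0 : ∀ k : ℕ, 0 < R * (1 - 1 / ((k : ℝ) + 2)) := fun k => by
    refine mul_pos hR (sub_pos.2 ?_)
    rw [div_lt_one (by positivity)]
    linarith [(Nat.cast_nonneg k : (0 : ℝ) ≤ k)]
  have hk : ∀ k : ℕ, ∀ᵐ x, x ∈ closedBall c (R * (1 - 1 / ((k : ℝ) + 2))) →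
      u x = 0 → g x = 0 := fun k => by
    let χ : ContDiffBump c := ⟨R * (1 - 1 / ((k : ℝ) + 2)),
      (R * (1 - 1 / ((k : ℝ) + 2)) + R) / 2, hr0 k, by linarith [hr k]⟩
    have hχ : IsTestFun (ball c R) χ := χ.isTestFun (closedBall_subset_ball (by
      change (R * (1 - 1 / ((k : ℝ) + 2)) + R) / 2 < R
      linarith [hr k]))
    have glob : ∀ {f : RH n → ℝ} {θ : RH n → ℝ}, IntegrableOn f (ball c R) →
        IsTestFun (ball c R) θ → Integrable fun x => f x * θ x := fun hf hθ =>
      (integrableOn_iff_integrable_of_support_subset fun x hx => by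
        by_contra hxB
        exact hx (by simp [hθ.eq_zero_of_notMem hxB])).1 (hθ.integrable_mul hf)
    filter_upwards [ae_weakPartial_eq_zero_of_integrable (glob hu hχ)
      ((glob hg hχ).add (glob hu (hχ.cpderiv i))) (hug.mul_isTestFun hu hg hχ)]
      with x hx hxk hux
    have h1 : χ x = 1 := χ.one_of_mem_closedBall hxk
    simpa [hux, h1] using hx
  rw [ae_restrict_iff' measurableSet_ball]
  filter_upwards [ae_all_iff.2 hk] with x hx hxB
  have hlim : Tendsto (fun k : ℕ => R * (1 - 1 / ((k : ℝ) + 2))) atTop (𝓝 R) := by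
    have h1 : Tendsto (fun k : ℕ => 1 / ((k : ℝ) + 2)) atTop (𝓝 0) :=
      tendsto_const_nhds.div_atTop
        (tendsto_atTop_add_const_right _ _ tendsto_natCast_atTop_atTop)
    simpa using (h1.const_sub 1).const_mul R
  obtain ⟨k, hk⟩ := (hlim.eventually_const_lt (mem_ball.1 hxB)).exists
  exact hx k (mem_closedBall.2 hk.le)

lemma IsH2With.isWeakLaplacian {Ω : Set (RH n)} [IsFiniteMeasure (volume.restrict Ω)]
    {u : RH n → ℝ} {g : Fin n → RH n → ℝ} {h : Fin n → Fin n → RH n → ℝ}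
    (H : IsH2With Ω u g h) : IsWeakLaplacian Ω u (fun x => ∑ i, h i i x) := by
  intro φ hφ
  have hu : IntegrableOn u Ω := H.1.integrable one_le_two
  have hh : ∀ i, IntegrableOn (h i i) Ω := fun i => (H.2.2 i i).2.integrable one_le_two
  simp only [cLaplacian, Finset.mul_sum, Finset.sum_mul]
  rw [integral_finsetSum _ fun i _ => ((hφ.cpderiv i).cpderiv i).integrable_mul hu,
    integral_finsetSum _ fun i _ => hφ.integrable_mul (hh i)]
  refine Finset.sum_congr rfl fun i _ => ?_
  rw [(H.2.1 i).1 _ (hφ.cpderiv i), (H.2.2 i i).1 _ hφ, neg_neg]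

lemma IsTestFun.integrableOn_mul_of_locallyIntegrableOn {Ω : Set (RH n)} {φ f : RH n → ℝ}
    (hφ : IsTestFun Ω φ) (hf : LocallyIntegrableOn f Ω) :
    Integrable (fun x => f x * φ x) := by
  refine (integrableOn_iff_integrable_of_support_subset fun x hx => ?_).1
    (hφ.integrable_mul (hf.integrableOn_compact_subset hφ.2.2 hφ.2.1))
  exact subset_tsupport _ fun h => hx (by simp [h])

/-- Locally integrable weak Laplacians are unique. -/
lemma IsWeakLaplacian.ae_eq {Ω : Set (RH n)} (hΩ : IsOpen Ω) {u a b : RH n → ℝ}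
    (ha : IsWeakLaplacian Ω u a) (hb : IsWeakLaplacian Ω u b)
    (hai : LocallyIntegrableOn a Ω) (hbi : LocallyIntegrableOn b Ω) :
    a =ᵐ[volume.restrict Ω] b := by
  have key := hΩ.ae_eq_zero_of_integral_contDiff_smul_eq_zero (hai.sub hbi) fun φ h1 h2 h3 => by
    have hφ : IsTestFun Ω φ := ⟨h1, h2, h3⟩
    have h := (ha φ hφ).symm.trans (hb φ hφ)
    rw [setIntegral_eq_integral_of_forall_compl_eq_zero fun x hx => by
        rw [hφ.eq_zero_of_notMem hx, mul_zero],
      setIntegral_eq_integral_of_forall_compl_eq_zero fun x hx => by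
        rw [hφ.eq_zero_of_notMem hx, mul_zero], ← sub_eq_zero,
      ← integral_sub (hφ.integrableOn_mul_of_locallyIntegrableOn hai)
        (hφ.integrableOn_mul_of_locallyIntegrableOn hbi)] at h
    rw [← h]
    congr 1 with x
    simp only [Pi.sub_apply, smul_eq_mul]
    ring
  rw [Filter.EventuallyEq, ae_restrict_iff' hΩ.measurableSet]
  filter_upwards [key] with x hx hxΩ
  exact sub_eq_zero.1 (hx hxΩ)

/-- If the integrable weak Laplacian `L` of `u` does not vanish, then any function satisfying the
integral identity defining the weak Laplacian is automatically locally integrable: at a point of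
non-integrability the identity would force `L` to vanish away from that point. -/
lemma IsWeakLaplacian.locallyIntegrableOn (hn : 0 < n) {Ω : Set (RH n)} (hΩ : IsOpen Ω)
    {u a L : RH n → ℝ} (ha : IsWeakLaplacian Ω u a) (hL : IsWeakLaplacian Ω u L)
    (hLi : IntegrableOn L Ω) (hne : ¬ L =ᵐ[volume.restrict Ω] 0) :
    LocallyIntegrableOn a Ω := by
  have : Nonempty (Fin n) := ⟨⟨0, hn⟩⟩
  by_contra hcon
  simp only [LocallyIntegrableOn, not_forall] at hcon
  obtain ⟨x, hxΩ, hx⟩ := hcon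
  have hnot : ∀ {ε : ℝ} {θ : RH n → ℝ}, 0 < ε → (∀ y ∈ ball x ε, θ y = 1) →
      ∫ y in Ω, a y * θ y = 0 := fun {ε θ} hε hθ => by
    refine integral_undef fun hi => hx ⟨Ω ∩ ball x ε, ?_, ?_⟩
    · exact inter_mem self_mem_nhdsWithin (mem_nhdsWithin_of_mem_nhds (ball_mem_nhds x hε))
    · refine (IntegrableOn.mono_set hi inter_subset_left).congr_fun (fun y hy => ?_)
        (hΩ.measurableSet.inter measurableSet_ball)
      simp [hθ y hy.2]
  have hzero := (hΩ.sdiff (isClosed_singleton (x := x))).ae_eq_zero_of_integral_contDiff_smul_eq_zero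
    (hLi.locallyIntegrableOn.mono_set sdiff_subset) fun ψ h1 h2 h3 => by
      have hψ : IsTestFun Ω ψ := ⟨h1, h2, h3.trans sdiff_subset⟩
      have hxψ : x ∈ Ω ∩ (tsupport ψ)ᶜ := ⟨hxΩ, fun h => (h3 h).2 rfl⟩
      obtain ⟨ε, hε, hball⟩ := Metric.isOpen_iff.1
        (hΩ.inter (isClosed_tsupport ψ).isOpen_compl) x hxψ
      let χ : ContDiffBump x := ⟨ε / 4, ε / 2, by positivity, by linarith⟩
      have hχ : IsTestFun Ω χ := χ.isTestFun ((closedBall_subset_ball (by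
        change ε / 2 < ε
        linarith)).trans (hball.trans inter_subset_left))
      have hχ1 : ∀ y ∈ ball x (ε / 4), χ y = 1 := fun y hy =>
        χ.one_of_mem_closedBall (ball_subset_closedBall hy)
      have hψ0 : ∀ y ∈ ball x (ε / 4), ψ y = 0 := fun y hy =>
        image_eq_zero_of_notMem_tsupport
          (hball (ball_subset_ball (by linarith) hy)).2
      have hsum : IsTestFun Ω (fun y => χ y + ψ y) :=
        ⟨hχ.1.add hψ.1, hχ.2.1.add hψ.2.1,
          (tsupport_add (f := χ) (g := ψ)).trans (union_subset hχ.2.2 hψ.2.2)⟩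
      have e1 : ∫ y in Ω, L y * χ y = 0 := by
        rw [← hL _ hχ, ha _ hχ]
        exact hnot (by positivity) hχ1
      have e2 : ∫ y in Ω, L y * (χ y + ψ y) = 0 := by
        rw [← hL _ hsum, ha _ hsum]
        exact hnot (ε := ε / 4) (by positivity) fun y hy => by rw [hχ1 y hy, hψ0 y hy, add_zero]
      simp only [mul_add] at e2
      rw [integral_add (hχ.integrable_mul hLi) (hψ.integrable_mul hLi), e1, zero_add,
        setIntegral_eq_integral_of_forall_compl_eq_zero fun y hy => by
          rw [hψ.eq_zero_of_notMem hy, mul_zero]] at e2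
      simpa only [smul_eq_mul, mul_comm] using e2
  refine hne ?_
  rw [Filter.EventuallyEq, ae_restrict_iff' hΩ.measurableSet]
  have hae : ∀ᵐ y : RH n, y ≠ x := by simp [ae_iff]
  filter_upwards [hzero, hae] with y hy hyx hyΩ
  exact hy ⟨hyΩ, hyx⟩

lemma IsTestFun.setIntegral_cpderiv {Ω : Set (RH n)} {φ : RH n → ℝ} (hφ : IsTestFun Ω φ)
    (i : Fin n) : ∫ x in Ω, _root_.cpderiv i φ x = 0 := by
  rw [setIntegral_eq_integral_of_forall_compl_eq_zero fun x hx =>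
    (hφ.cpderiv i).eq_zero_of_notMem hx]
  have := integral_mul_fderiv_eq_neg_fderiv_mul_of_integrable (μ := (volume : Measure (RH n)))
    (f := fun _ => (1 : ℝ)) (g := φ) (v := EuclideanSpace.single i 1) (by simp)
    (by simp only [one_mul]; exact (hφ.cpderiv i).integrable) (by simpa using hφ.integrable)
    (fun x _ => differentiableAt_const _) (fun x _ => hφ.1.differentiable (by simp) x)
  simpa [_root_.cpderiv] using this

/-- The Laplacian of an `H₀²` function has vanishing integral. -/
lemma MemH20.exists_setIntegral_laplacian_eq_zero {Ω : Set (RH n)}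
    [IsFiniteMeasure (volume.restrict Ω)] {u : RH n → ℝ} (hu : MemH20 Ω u) :
    ∃ g h, IsH2With Ω u g h ∧ ∫ x in Ω, ∑ i, h i i x = 0 := by
  obtain ⟨g, h, H, φ, hφ, -, -, hlim⟩ := hu
  refine ⟨g, h, H, ?_⟩
  have hh : ∀ i, IntegrableOn (h i i) Ω := fun i => (H.2.2 i i).2.integrable one_le_two
  rw [integral_finsetSum _ fun i _ => hh i]
  refine Finset.sum_eq_zero fun i _ => ?_
  have hφi : ∀ k, Integrable (cpderiv i (cpderiv i (φ k))) (volume.restrict Ω) := fun k =>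
    (((hφ k).cpderiv i).cpderiv i).integrable.integrableOn
  have hL1 : Tendsto (fun k => eLpNorm (cpderiv i (cpderiv i (φ k)) - h i i) 1
      (volume.restrict Ω)) atTop (𝓝 0) := by
    have hc := ENNReal.Tendsto.mul_const (b := (volume.restrict Ω) univ ^ (1 / (1 : ℝ≥0∞).toReal
      - 1 / (2 : ℝ≥0∞).toReal)) (hlim i i) (Or.inr (by
        refine ENNReal.rpow_ne_top_of_nonneg (by norm_num) (measure_ne_top _ _)))
    rw [zero_mul] at hc
    refine tendsto_of_tendsto_of_tendsto_of_le_of_le tendsto_const_nhds hc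
      (fun k => zero_le) fun k => ?_
    dsimp only
    rw [eLpNorm_sub_comm]
    exact eLpNorm_le_eLpNorm_mul_rpow_measure_univ one_le_two
      ((hh i).sub (hφi k)).aestronglyMeasurable
  have := tendsto_integral_of_L1' (h i i) (hh i).aestronglyMeasurable
    (Eventually.of_forall hφi) hL1
  simp only [((hφ _).cpderiv i).setIntegral_cpderiv i] at this
  exact (tendsto_nhds_unique this tendsto_const_nhds)

/-- The weak Laplacian vanishes almost everywhere on the zero set of the function. -/
lemma IsH2With.ae_laplacian_eq_zero {c : RH n} {R : ℝ} (hR : 0 < R) {u : RH n → ℝ}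
    {g : Fin n → RH n → ℝ} {h : Fin n → Fin n → RH n → ℝ} (H : IsH2With (ball c R) u g h) :
    ∀ᵐ x ∂volume.restrict (ball c R), u x = 0 → ∑ i, h i i x = 0 := by
  have : IsFiniteMeasure (volume.restrict (ball c R)) :=
    isFiniteMeasure_restrict.2 measure_ball_lt_top.ne
  have hu := H.1.integrable one_le_two
  have hg : ∀ i, IntegrableOn (g i) (ball c R) := fun i => (H.2.1 i).2.integrable one_le_two
  have hh : ∀ i, IntegrableOn (h i i) (ball c R) := fun i =>
    (H.2.2 i i).2.integrable one_le_two
  filter_upwards [ae_all_iff.2 fun i => (H.2.1 i).1.ae_eq_zero hR hu (hg i),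
    ae_all_iff.2 fun i => (H.2.2 i i).1.ae_eq_zero hR (hg i) (hh i)] with x h1 h2 hx
  exact Finset.sum_eq_zero fun i _ => h2 i (h1 i hx)

/-- the energy identity
`F(v,B) - F(w,B) = (C² - 1)|B ∩ {v = 0}| + ∫_{B ∩ {v ≠ 0}} (Δ(v-w))² dx ≥ 0`
for `w` with constant weak Laplacian `C`, `|C| ≥ 1`, and competitors `v`. -/
theorem statement10 (n : ℕ) (hn : 0 < n) (R : ℝ) (hR : 0 < R)
    (w : RH n → ℝ) (C : ℝ) (hC : 1 ≤ |C|) (hw : MemH2loc w)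
    (hlapw : IsWeakLaplacian (ball (0 : RH n) R) w (fun _ => C))
    (v lapv : RH n → ℝ) (hv : MemH2 (ball (0 : RH n) R) v)
    (hv0 : MemH20 (ball (0 : RH n) R) (fun x => v x - w x))
    (hlapv : IsWeakLaplacian (ball (0 : RH n) R) v lapv) :
    ACF (ball (0 : RH n) R) lapv v - ACF (ball (0 : RH n) R) (fun _ => C) w
      = (C ^ 2 - 1) * (volume (ball (0 : RH n) R ∩ {x : RH n | v x = 0})).toReal
        + ∫ x in (ball (0 : RH n) R ∩ {x : RH n | v x ≠ 0}), (lapv x - C) ^ 2 ∧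
    0 ≤ ACF (ball (0 : RH n) R) lapv v - ACF (ball (0 : RH n) R) (fun _ => C) w := by
  have : IsFiniteMeasure (volume.restrict (ball (0 : RH n) R)) :=
    isFiniteMeasure_restrict.2 measure_ball_lt_top.ne
  have hB : 0 < (volume : Measure (RH n)).real (ball 0 R) :=
    ENNReal.toReal_pos (measure_ball_pos volume 0 hR).ne' measure_ball_lt_top.ne
  have hC0 : C ≠ 0 := fun h => by norm_num [h] at hC
  obtain ⟨gw, hw', Hw⟩ := hw (ball 0 R) isOpen_ball isBounded_ball
  obtain ⟨gv, hv', Hv⟩ := hv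
  obtain ⟨gd, hd, Hd, hd0⟩ := hv0.exists_setIntegral_laplacian_eq_zero
  have lapMem : ∀ {u : RH n → ℝ} {g : Fin n → RH n → ℝ} {h : Fin n → Fin n → RH n → ℝ},
      IsH2With (ball (0 : RH n) R) u g h →
        MemLp (fun x => ∑ i, h i i x) 2 (volume.restrict (ball (0 : RH n) R)) := fun H =>
    memLp_finsetSum _ fun i _ => (H.2.2 i i).2
  have lapInt : ∀ {u : RH n → ℝ} {g : Fin n → RH n → ℝ} {h : Fin n → Fin n → RH n → ℝ},
      IsH2With (ball (0 : RH n) R) u g h →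
        IntegrableOn (fun x => ∑ i, h i i x) (ball (0 : RH n) R) := fun H =>
    (lapMem H).integrable one_le_two
  have hCint : IntegrableOn (fun _ : RH n => C) (ball 0 R) := integrable_const C
  have hw0 : ∀ᵐ x ∂volume.restrict (ball (0 : RH n) R), w x ≠ 0 := by
    filter_upwards [hlapw.ae_eq isOpen_ball Hw.isWeakLaplacian hCint.locallyIntegrableOn
      (lapInt Hw).locallyIntegrableOn, Hw.ae_laplacian_eq_zero hR] with x h1 h2 hx
    exact hC0 (h1.trans (h2 hx))
  have hdiff : IsWeakLaplacian (ball (0 : RH n) R) (fun x => v x - w x)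
      (fun x => ∑ i, hv' i i x - C) := fun φ hφ => by
    have hΔ : ContDiff ℝ (⊤ : ℕ∞) (cLaplacian φ) :=
      ContDiff.sum fun i _ => ((hφ.cpderiv i).cpderiv i).1
    have hsub : ∀ {f : RH n → ℝ}, IntegrableOn f (ball (0 : RH n) R) →
        IntegrableOn (fun x => f x * cLaplacian φ x) (ball (0 : RH n) R) := fun hf => by
      simp only [cLaplacian, Finset.mul_sum]
      exact integrable_finsetSum _ fun i _ => ((hφ.cpderiv i).cpderiv i).integrable_mul hf
    simp only [sub_mul]
    rw [integral_sub (hsub (Hv.1.integrable one_le_two)) (hsub (Hw.1.integrable one_le_two)),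
      integral_sub (hφ.integrable_mul (lapInt Hv)) (hφ.integrable_mul hCint),
      Hv.isWeakLaplacian φ hφ, hlapw φ hφ]
  have hLint : ∫ x in ball (0 : RH n) R, ∑ i, hv' i i x
      = C * (volume : Measure (RH n)).real (ball 0 R) := by
    have h1 := integral_congr_ae (Hd.isWeakLaplacian.ae_eq isOpen_ball hdiff
      (lapInt Hd).locallyIntegrableOn ((lapInt Hv).sub hCint).locallyIntegrableOn)
    rw [hd0, integral_sub (lapInt Hv) hCint, setIntegral_const, smul_eq_mul] at h1
    linarith
  have hlap : lapv =ᵐ[volume.restrict (ball (0 : RH n) R)] fun x => ∑ i, hv' i i x := by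
    refine hlapv.ae_eq isOpen_ball Hv.isWeakLaplacian
      (hlapv.locallyIntegrableOn hn isOpen_ball Hv.isWeakLaplacian (lapInt Hv) fun h => ?_)
      (lapInt Hv).locallyIntegrableOn
    rw [integral_congr_ae h] at hLint
    simp only [Pi.zero_apply, integral_zero] at hLint
    exact (mul_ne_zero hC0 hB.ne') hLint.symm
  have hmem : MemLp lapv 2 (volume.restrict (ball (0 : RH n) R)) := (lapMem Hv).ae_eq hlap.symm
  have hint : Integrable lapv (volume.restrict (ball (0 : RH n) R)) := hmem.integrable one_le_two
  have hlap0 : ∀ᵐ x ∂volume.restrict (ball (0 : RH n) R), v x = 0 → lapv x = 0 := by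
    filter_upwards [hlap, Hv.ae_laplacian_eq_zero hR] with x h1 h2 hx
    exact h1.trans (h2 hx)
  have hlapint : ∫ x in ball (0 : RH n) R, lapv x
      = C * (volume : Measure (RH n)).real (ball 0 R) := (integral_congr_ae hlap).trans hLint
  have hZ : NullMeasurableSet {x | v x = 0} (volume.restrict (ball (0 : RH n) R)) :=
    Hv.1.aestronglyMeasurable.aemeasurable.nullMeasurable (measurableSet_singleton (0 : ℝ))
  have hN : NullMeasurableSet {x | v x ≠ 0} (volume.restrict (ball (0 : RH n) R)) := hZ.compl
  have hsplit := measureReal_add_measureReal_compl₀ hZ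
  have hNZ : {x | v x = 0}ᶜ = {x | v x ≠ 0} := rfl
  rw [hNZ, measureReal_restrict_apply_univ] at hsplit
  have hvolZ : (volume (ball (0 : RH n) R ∩ {x | v x = 0})).toReal
      = (volume.restrict (ball (0 : RH n) R)).real {x | v x = 0} := by
    rw [measureReal_def, Measure.restrict_apply₀ hZ, inter_comm]
  have hvolN : (volume {x ∈ ball (0 : RH n) R | v x ≠ 0}).toReal
      = (volume.restrict (ball (0 : RH n) R)).real {x | v x ≠ 0} := by
    rw [measureReal_def, Measure.restrict_apply₀ hN, inter_comm]
    rfl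
  have hvolw : (volume {x ∈ ball (0 : RH n) R | w x ≠ 0}).toReal
      = (volume : Measure (RH n)).real (ball 0 R) := by
    rw [measureReal_def]
    congr 1
    refine measure_congr ?_
    rw [ae_restrict_iff' measurableSet_ball] at hw0
    filter_upwards [hw0] with x hx
    exact propext ⟨fun h => h.1, fun h => ⟨h, hx h⟩⟩
  have hsq : ∫ x in ball (0 : RH n) R ∩ {x | v x ≠ 0}, (lapv x - C) ^ 2
      = (∫ x in ball (0 : RH n) R, lapv x ^ 2)
        - 2 * C * (C * (volume : Measure (RH n)).real (ball 0 R))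
        + C ^ 2 * (volume.restrict (ball (0 : RH n) R)).real {x | v x ≠ 0} := by
    rw [inter_comm, ← Measure.restrict_restrict₀ hN, ← hlapint,
      ← setIntegral_eq_integral_of_ae_compl_eq_zero (s := {x | v x ≠ 0}) (f := lapv)
        (hlap0.mono fun x hx hxN => hx (not_not.1 hxN)),
      ← setIntegral_eq_integral_of_ae_compl_eq_zero (s := {x | v x ≠ 0})
        (f := fun x => lapv x ^ 2)
        (hlap0.mono fun x hx hxN => by rw [hx (not_not.1 hxN), sq, mul_zero])]
    have e : ∀ x, (lapv x - C) ^ 2 = lapv x ^ 2 - 2 * C * lapv x + C ^ 2 := fun x => by ring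
    have i1 := hmem.integrable_sq.integrableOn (s := {x | v x ≠ 0})
    have i2 := (hint.const_mul (2 * C)).integrableOn (s := {x | v x ≠ 0})
    simp only [e]
    refine (integral_add (i1.sub i2) (integrable_const _)).trans ?_
    rw [integral_sub' i1 i2, integral_const_mul, setIntegral_const, smul_eq_mul,
      mul_comm (C ^ 2)]
  have hmain : ACF (ball (0 : RH n) R) lapv v - ACF (ball (0 : RH n) R) (fun _ => C) w
      = (C ^ 2 - 1) * (volume (ball (0 : RH n) R ∩ {x : RH n | v x = 0})).toReal
        + ∫ x in (ball (0 : RH n) R ∩ {x : RH n | v x ≠ 0}), (lapv x - C) ^ 2 := by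
    rw [hsq, ACF, ACF, hvolN, hvolw, hvolZ, setIntegral_const, smul_eq_mul, ← hsplit]
    ring
  refine ⟨hmain, ?_⟩
  rw [hmain]
  have hC2 : 0 ≤ C ^ 2 - 1 := by
    rw [← sq_abs]
    nlinarith
  exact add_nonneg (mul_nonneg hC2 ENNReal.toReal_nonneg)
    (integral_nonneg fun x => sq_nonneg _)

end
end

section
/- Let Ω = (−R, R) ⊂ ℝ with R > √3 + 1/√3, and let u : Ω → ℝ be defined by u(x) = 0 for |x| ≤ R − √3 and u(x) = (|x| − R + √3)²(R + 2√3 − |x|)/(6√3) for |x| > R − √3. Then for every φ ∈ C₀^∞(Ω) one has ∫_Ω u''(x)φ''(x) dx = (φ'(−R+√3) − φ'(R−√3)) − (1/√3)(φ(R−√3) + φ(−R+√3)). -/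
open MeasureTheory Metric Set Filter Topology
open scoped ENNReal

noncomputable section

/-- Smooth compactly supported test functions on `ℝ` with support contained in `Ω`. -/
def IsTestFun1 (Ω : Set ℝ) (φ : ℝ → ℝ) : Prop :=
  ContDiff ℝ (⊤ : ℕ∞) φ ∧ HasCompactSupport φ ∧ tsupport φ ⊆ Ω

/-- `g` is the weak derivative of `u` on `Ω ⊆ ℝ`. -/
def IsWeakDeriv1 (Ω : Set ℝ) (u g : ℝ → ℝ) : Prop :=
  ∀ φ : ℝ → ℝ, IsTestFun1 Ω φ →
    ∫ x in Ω, u x * deriv φ x = - ∫ x in Ω, g x * φ x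

/-- `g` is the weak second derivative (one-dimensional Laplacian) of `u` on `Ω ⊆ ℝ`. -/
def IsWeakLaplacian1 (Ω : Set ℝ) (u g : ℝ → ℝ) : Prop :=
  ∀ φ : ℝ → ℝ, IsTestFun1 Ω φ →
    ∫ x in Ω, u x * deriv (deriv φ) x = ∫ x in Ω, g x * φ x

/-- `u ∈ H²(Ω)` with weak first derivative `g` and weak second derivative `h`. -/
def IsH2With1 (Ω : Set ℝ) (u g h : ℝ → ℝ) : Prop :=
  MemLp u 2 (volume.restrict Ω) ∧
  IsWeakDeriv1 Ω u g ∧ MemLp g 2 (volume.restrict Ω) ∧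
  IsWeakDeriv1 Ω g h ∧ MemLp h 2 (volume.restrict Ω)

/-- `u ∈ H²(Ω)`, `Ω ⊆ ℝ`. -/
def MemH21 (Ω : Set ℝ) (u : ℝ → ℝ) : Prop := ∃ g h, IsH2With1 Ω u g h

/-- `u ∈ H₀²(Ω)`, `Ω ⊆ ℝ`: `u ∈ H²(Ω)` and `u` is approximable in the `H²`-norm by
test functions supported in `Ω`. -/
def MemH201 (Ω : Set ℝ) (u : ℝ → ℝ) : Prop :=
  ∃ g h, IsH2With1 Ω u g h ∧
    ∃ φ : ℕ → ℝ → ℝ, (∀ k, IsTestFun1 Ω (φ k)) ∧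
      Tendsto (fun k => eLpNorm (fun x => u x - φ k x) 2 (volume.restrict Ω)) atTop (𝓝 0) ∧
      Tendsto (fun k => eLpNorm (fun x => g x - deriv (φ k) x) 2 (volume.restrict Ω)) atTop (𝓝 0) ∧
      Tendsto (fun k => eLpNorm (fun x => h x - deriv (deriv (φ k)) x) 2 (volume.restrict Ω))
        atTop (𝓝 0)

/-- `u ∈ H²_loc(ℝ)`. -/
def MemH2loc1 (u : ℝ → ℝ) : Prop :=
  ∀ Ω : Set ℝ, IsOpen Ω → Bornology.IsBounded Ω → MemH21 Ω u

/-- The one-sided biharmonic Alt–Caffarelli functional in dimension one,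
`F̃(u,Ω) = ∫_Ω (u'')² dx + |{x ∈ Ω : u x > 0}|`, where the weak second
derivative `u'' = lapu` is given explicitly. -/
def ACFT1 (Ω : Set ℝ) (lapu u : ℝ → ℝ) : ℝ :=
  (∫ x in Ω, (lapu x) ^ 2) + (volume {x ∈ Ω | 0 < u x}).toReal

/-- `u` is a global minimizer of the one-sided biharmonic Alt–Caffarelli
functional `F̃` in dimension one. -/
def IsGlobalMinimizerT1 (u : ℝ → ℝ) : Prop :=
  MemH2loc1 u ∧
  ∀ Ω : Set ℝ, IsOpen Ω → Bornology.IsBounded Ω →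
    ∀ v : ℝ → ℝ, MemH21 Ω v → MemH201 Ω (fun x => v x - u x) →
      ∀ lapu lapv : ℝ → ℝ, IsWeakLaplacian1 Ω u lapu → IsWeakLaplacian1 Ω v lapv →
        ACFT1 Ω lapu u ≤ ACFT1 Ω lapv v

/-- On a symmetric interval, a function supported in `a < |x| < R` and even there integrates
against `f` as it does on `(a, R)` against `f x + f (-x)`. -/
theorem integral_ite_abs_mul {a R : ℝ} (ha : 0 ≤ a) (haR : a ≤ R) {p f : ℝ → ℝ}
    (hp : Continuous p) (hf : Continuous f) :
    ∫ x in Set.Ioo (-R) R, (if |x| ≤ a then (0 : ℝ) else p |x|) * f x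
      = ∫ x in a..R, p x * (f x + f (-x)) := by
  have hsplit : Set.Ioo (-R) R ∩ {x | |x| ≤ a}ᶜ = Set.Ioo (-R) (-a) ∪ Set.Ioo a R := by
    ext x
    simp only [Set.mem_inter_iff, Set.mem_Ioo, Set.mem_compl_iff, Set.mem_ofPred_eq, not_le,
      Set.mem_union, lt_abs]
    constructor
    · rintro ⟨⟨h1, h2⟩, h | h⟩
      · exact Or.inr ⟨h, h2⟩
      · exact Or.inl ⟨h1, by linarith⟩
    · rintro (⟨h1, h2⟩ | ⟨h1, h2⟩)
      · exact ⟨⟨h1, by linarith⟩, Or.inr (by linarith)⟩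
      · exact ⟨⟨by linarith, h2⟩, Or.inl h1⟩
  have hdisj : Disjoint (Set.Ioo (-R) (-a)) (Set.Ioo a R) :=
    Set.disjoint_left.2 fun x h1 h2 => by linarith [h1.2, h2.1]
  have hmeas : MeasurableSet {x : ℝ | |x| ≤ a}ᶜ :=
    (isClosed_le continuous_abs continuous_const).measurableSet.compl
  have hc : Continuous fun x => p |x| * f x := (hp.comp continuous_abs).mul hf
  have hint : ∀ c d : ℝ, IntegrableOn (fun x => p |x| * f x) (Set.Ioo c d) := fun c d =>
    (hc.integrableOn_Icc).mono_set Set.Ioo_subset_Icc_self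
  have hind : (fun x => (if |x| ≤ a then (0 : ℝ) else p |x|) * f x)
      = Set.indicator {x : ℝ | |x| ≤ a}ᶜ fun x => p |x| * f x := by
    ext x
    by_cases h : |x| ≤ a <;> simp [h, -not_le]
  rw [hind, setIntegral_indicator hmeas, hsplit,
    setIntegral_union hdisj measurableSet_Ioo (hint _ _) (hint _ _),
    ← integral_Ioc_eq_integral_Ioo, ← integral_Ioc_eq_integral_Ioo,
    ← intervalIntegral.integral_of_le (by linarith), ← intervalIntegral.integral_of_le haR,
    ← intervalIntegral.integral_comp_neg (fun x => p |x| * f x),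
    ← intervalIntegral.integral_add]
  · refine intervalIntegral.integral_congr fun x hx => ?_
    rw [Set.uIcc_of_le haR] at hx
    simp only [abs_neg, abs_of_nonneg (ha.trans hx.1)]
    ring
  · exact (hc.comp continuous_neg).intervalIntegrable _ _
  · exact hc.intervalIntegrable _ _

/-- Green's identity in one dimension. -/
theorem integral_mul_sub_mul_eq_wronskian {a b : ℝ} {p p' p'' g g' g'' : ℝ → ℝ}
    (hp : ∀ x, HasDerivAt p (p' x) x) (hp' : ∀ x, HasDerivAt p' (p'' x) x)
    (hg : ∀ x, HasDerivAt g (g' x) x) (hg' : ∀ x, HasDerivAt g' (g'' x) x)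
    (hp'' : Continuous p'') (hg'' : Continuous g'') :
    (∫ x in a..b, p x * g'' x) - ∫ x in a..b, p'' x * g x
      = (p b * g' b - p' b * g b) - (p a * g' a - p' a * g a) := by
  have cp : Continuous p := continuous_iff_continuousAt.2 fun x => (hp x).continuousAt
  have cg : Continuous g := continuous_iff_continuousAt.2 fun x => (hg x).continuousAt
  have i1 : Continuous fun x => p x * g'' x := cp.mul hg''
  have i2 : Continuous fun x => p'' x * g x := hp''.mul cg
  rw [← intervalIntegral.integral_sub (i1.intervalIntegrable _ _) (i2.intervalIntegrable _ _)]
  refine intervalIntegral.integral_eq_sub_of_hasDerivAt (f := fun x => p x * g' x - p' x * g x)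
    (fun x _ => ?_) ((i1.sub i2).intervalIntegrable _ _)
  refine (((hp x).mul (hg' x)).sub ((hp' x).mul (hg x))).congr_deriv ?_
  ring

/-- for `Ω = (-R,R)`, `R > √3 + 1/√3`, the explicit minimizer `u`
has weak second derivative `u''(x) = 0` for `|x| ≤ R - √3` and `(R - |x|)/√3`
otherwise, and for every test function `φ ∈ C₀^∞(Ω)` one has
`∫ u'' φ'' = (φ'(-R+√3) - φ'(R-√3)) - (1/√3)(φ(R-√3) + φ(-R+√3))`. -/
theorem statement14 (R : ℝ) (hR : Real.sqrt 3 + 1 / Real.sqrt 3 < R) :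
    ∀ φ : ℝ → ℝ, IsTestFun1 (Set.Ioo (-R) R) φ →
      (∫ x in Set.Ioo (-R) R,
          (if |x| ≤ R - Real.sqrt 3 then (0 : ℝ) else
            (|x| - R + Real.sqrt 3) ^ 2 * (R + 2 * Real.sqrt 3 - |x|) / (6 * Real.sqrt 3))
          * deriv (deriv φ) x
        = ∫ x in Set.Ioo (-R) R,
          (if |x| ≤ R - Real.sqrt 3 then (0 : ℝ) else (R - |x|) / Real.sqrt 3) * φ x) ∧
      ∫ x in Set.Ioo (-R) R,
          (if |x| ≤ R - Real.sqrt 3 then (0 : ℝ) else (R - |x|) / Real.sqrt 3)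
          * deriv (deriv φ) x
        = (deriv φ (-R + Real.sqrt 3) - deriv φ (R - Real.sqrt 3))
          - (1 / Real.sqrt 3) * (φ (R - Real.sqrt 3) + φ (-R + Real.sqrt 3)) := by
  rintro φ ⟨hφ, -, hsupp⟩
  set s := Real.sqrt 3
  have hs0 : 0 < s := Real.sqrt_pos.2 (by norm_num)
  have hsR : s < R := by linarith [one_div_pos.2 hs0]
  have hφ1 : ContDiff ℝ (⊤ : ℕ∞) (deriv φ) := (contDiff_infty_iff_deriv.1 hφ).2
  have hφ2 : ContDiff ℝ (⊤ : ℕ∞) (deriv (deriv φ)) := (contDiff_infty_iff_deriv.1 hφ1).2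
  have dφ : ∀ x, HasDerivAt φ (deriv φ x) x := fun x =>
    (contDiff_infty_iff_deriv.1 hφ).1.differentiableAt.hasDerivAt
  have dφ1 : ∀ x, HasDerivAt (deriv φ) (deriv (deriv φ) x) x := fun x =>
    (contDiff_infty_iff_deriv.1 hφ1).1.differentiableAt.hasDerivAt
  have hR' : R ∉ tsupport φ := fun h => lt_irrefl _ (hsupp h).2
  have hnR : -R ∉ tsupport φ := fun h => lt_irrefl _ (hsupp h).1
  have hφR : φ R = 0 := image_eq_zero_of_notMem_tsupport hR'
  have hφnR : φ (-R) = 0 := image_eq_zero_of_notMem_tsupport hnR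
  have hdR : deriv φ R = 0 := by
    by_contra h
    exact hR' (support_deriv_subset h)
  have hdnR : deriv φ (-R) = 0 := by
    by_contra h
    exact hnR (support_deriv_subset h)
  have dg : ∀ x, HasDerivAt (fun x => φ x + φ (-x)) (deriv φ x - deriv φ (-x)) x := fun x =>
    ((dφ x).add ((dφ (-x)).comp x (hasDerivAt_neg x))).congr_deriv (by ring)
  have dg' : ∀ x, HasDerivAt (fun x => deriv φ x - deriv φ (-x))
      (deriv (deriv φ) x + deriv (deriv φ) (-x)) x := fun x =>
    ((dφ1 x).sub ((dφ1 (-x)).comp x (hasDerivAt_neg x))).congr_deriv (by ring)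
  have cg'' : Continuous fun x => deriv (deriv φ) x + deriv (deriv φ) (-x) :=
    hφ2.continuous.add (hφ2.continuous.comp continuous_neg)
  have du : ∀ x : ℝ, HasDerivAt
      (fun x => (x - R + s) ^ 2 * (R + 2 * s - x) / (6 * s))
      ((x - R + s) * (R + s - x) / (2 * s)) x := fun x => by
    have h1 : HasDerivAt (fun x : ℝ => x - R + s) 1 x := ((hasDerivAt_id x).sub_const R).add_const s
    have h2 : HasDerivAt (fun x : ℝ => R + 2 * s - x) (-1) x :=
      (hasDerivAt_id x).const_sub (R + 2 * s)
    refine (((h1.pow 2).mul h2).div_const (6 * s)).congr_deriv ?_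
    field_simp
    simp
    ring
  have du' : ∀ x : ℝ, HasDerivAt (fun x => (x - R + s) * (R + s - x) / (2 * s))
      ((R - x) / s) x := fun x => by
    have h1 : HasDerivAt (fun x : ℝ => x - R + s) 1 x := ((hasDerivAt_id x).sub_const R).add_const s
    have h2 : HasDerivAt (fun x : ℝ => R + s - x) (-1) x :=
      (hasDerivAt_id x).const_sub (R + s)
    refine ((h1.mul h2).div_const (2 * s)).congr_deriv ?_
    field_simp
    ring
  have du'' : ∀ x : ℝ, HasDerivAt (fun x => (R - x) / s) (-1 / s) x := fun x =>
    ((hasDerivAt_id x).const_sub R).div_const s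
  have cu : Continuous fun x : ℝ => (x - R + s) ^ 2 * (R + 2 * s - x) / (6 * s) := by fun_prop
  have cu'' : Continuous fun x : ℝ => (R - x) / s := by fun_prop
  have ha : 0 ≤ R - s := by linarith
  have haR : R - s ≤ R := by linarith
  constructor
  · have green := integral_mul_sub_mul_eq_wronskian (a := R - s) (b := R) du du' dg dg' cu'' cg''
    rw [integral_ite_abs_mul ha haR cu hφ2.continuous,
      integral_ite_abs_mul ha haR cu'' hφ.continuous, ← sub_eq_zero, green]
    simp [hφR, hφnR, hdR, hdnR]
  · have green := integral_mul_sub_mul_eq_wronskian (a := R - s) (b := R) du''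
      (fun x => hasDerivAt_const x (-1 / s)) dg dg' continuous_const cg''
    rw [integral_ite_abs_mul ha haR cu'' hφ2.continuous]
    simp only [zero_mul, intervalIntegral.integral_zero, sub_zero, hφR, hφnR, hdR, hdnR] at green
    rw [green, show -(R - s) = -R + s by ring]
    field_simp
    ring

end
end
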